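/- Let S = {(x,y,z) ∈ ℤ³ : 0 ≤ y ≤ x and 0 ≤ z ≤ x} and JMon = {a ∈ S : h_i(a) > 0 for all i = 1,2,3,4}. For every d ∈ ℤ³, the vanishing ideal in ℂ[θ₁,θ₂,θ₃] of the set {a ∈ S : a + d ∉ JMon} is the principal ideal generated by ∏_{i ∈ {1,2,3,4} with h_i(d) ≤ 0} (H_i, h_i(−d))!, where the product is over those indices i with h_i(d) ≤ 0 and an empty product is 1. (This computes all graded pieces of D(R_A, J) for J = ⟨t₁²t₂t₃⟩.) -/

import Mathlib

open MvPolynomial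

noncomputable section

/-- The polynomial ring ℂ[θ₁, θ₂, θ₃]. -/
abbrev Cθ3 : Type := MvPolynomial (Fin 3) ℂ

/-- The vanishing ideal of a set `V ⊆ ℤ³` inside ℂ[θ₁, θ₂, θ₃]. -/
def vanishingIdeal (V : Set (ℤ × ℤ × ℤ)) : Ideal Cθ3 where
  carrier := {f | ∀ a ∈ V, eval ![(a.1 : ℂ), (a.2.1 : ℂ), (a.2.2 : ℂ)] f = 0}
  add_mem' := by
    intro f g hf hg a ha
    simp [map_add, hf a ha, hg a ha]
  zero_mem' := by
    intro a _
    simp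
  smul_mem' := by
    intro c f hf a ha
    simp [smul_eq_mul, hf a ha]

/-- The descending factorial `(P, m)! = ∏_{j=0}^{m} (P - j)`, equal to `1` when `m < 0`. -/
def dfact (P : Cθ3) (m : ℤ) : Cθ3 :=
  ∏ j ∈ Finset.range (m + 1).toNat, (P - C (j : ℂ))

/-- `S = {(x, y, z) ∈ ℤ³ : 0 ≤ y ≤ x and 0 ≤ z ≤ x}`, the exponent set of the normal
affine semigroup ring `R_A = ℂ[t₁, t₁t₂, t₁t₃, t₁t₂t₃]`. -/
def Sset3 : Set (ℤ × ℤ × ℤ) :=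
  {a | 0 ≤ a.2.1 ∧ a.2.1 ≤ a.1 ∧ 0 ≤ a.2.2 ∧ a.2.2 ≤ a.1}

/-- `JMon = {a ∈ S : h_i(a) > 0 for i = 1, 2, 3, 4}`, the exponents of monomials of the
interior ideal `J = ⟨t₁²t₂t₃⟩`, where `h₁(a) = a₃`, `h₂(a) = a₂`, `h₃(a) = a₁ − a₃`,
`h₄(a) = a₁ − a₂`. -/
def JMon3 : Set (ℤ × ℤ × ℤ) :=
  {a | a ∈ Sset3 ∧ 0 < a.2.2 ∧ 0 < a.2.1 ∧ 0 < a.1 - a.2.2 ∧ 0 < a.1 - a.2.1}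

/-- `Ω(d) = {a ∈ S : a + d ∉ S}`. -/
def Omega3 (d : ℤ × ℤ × ℤ) : Set (ℤ × ℤ × ℤ) := {a | a ∈ Sset3 ∧ a + d ∉ Sset3}

/-- The linear forms `H₁, H₂, H₃, H₄`, indexed from zero. -/
def facetForm : Fin 4 → Cθ3 := ![X 2, X 1, X 0 - X 2, X 0 - X 1]

/-- The primitive integral support functions `h₁, h₂, h₃, h₄`, indexed from zero. -/
def supportFn (a : ℤ × ℤ × ℤ) : Fin 4 → ℤ := ![a.2.2, a.2.1, a.1 - a.2.2, a.1 - a.2.1]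

/-- A parametrization of the plane `H_i = j` which sends `ℕ³` into `S`. -/
def facetParam (j : ℕ) : Fin 4 → Fin 3 → Cθ3 :=
  ![![X 0 + X 1 + C (j : ℂ), X 1, C (j : ℂ)],
    ![X 0 + X 2 + C (j : ℂ), C (j : ℂ), X 2],
    ![X 1 + X 2 + C (j : ℂ), X 1, X 1 + X 2],
    ![X 1 + X 2 + C (j : ℂ), X 1 + X 2, X 2]]

/-- A left inverse of `facetParam` modulo `H_i - j`. -/
def facetSection (j : ℕ) : Fin 4 → Fin 3 → Cθ3 :=
  ![![X 0 - X 1 - C (j : ℂ), X 1, X 2],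
    ![X 0 - X 2 - C (j : ℂ), X 1, X 2],
    ![X 0, X 1, X 2 - X 1],
    ![X 0, X 1 - X 2, X 2]]

/-- The values of `facetParam` at points of `ℕ³`. -/
def facetPoint (j : ℕ) (n : Fin 3 → ℕ) : Fin 4 → ℤ × ℤ × ℤ :=
  ![(n 0 + n 1 + j, n 1, j), (n 0 + n 2 + j, j, n 2),
    (n 1 + n 2 + j, n 1, n 1 + n 2), (n 1 + n 2 + j, n 1 + n 2, n 2)]

lemma dvd_iff_of_aeval_section {σ τ R : Type*} [CommRing R] {L : MvPolynomial σ R}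
    (φ : σ → MvPolynomial τ R) (ψ : τ → MvPolynomial σ R) (hL : aeval φ L = 0)
    (h : ∀ k, L ∣ X k - aeval ψ (φ k)) (f : MvPolynomial σ R) :
    L ∣ f ↔ aeval φ f = 0 := by
  refine ⟨fun ⟨c, hc⟩ ↦ by rw [hc, map_mul, hL, zero_mul], fun hf ↦ ?_⟩
  have key : ((Ideal.Quotient.mkₐ R (Ideal.span {L})).comp ((aeval ψ).comp (aeval φ))) =
      Ideal.Quotient.mkₐ R (Ideal.span {L}) := by
    ext k
    simp only [AlgHom.comp_apply, aeval_X, Ideal.Quotient.mkₐ_eq_mk]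
    rw [eq_comm, Ideal.Quotient.eq, Ideal.mem_span_singleton]
    exact h k
  have := DFunLike.congr_fun key f
  simp only [AlgHom.comp_apply, hf, map_zero, Ideal.Quotient.mkₐ_eq_mk] at this
  rwa [eq_comm, Ideal.Quotient.eq_zero_iff_mem, Ideal.mem_span_singleton] at this

lemma facetForm_sub_dvd_iff (i : Fin 4) (j : ℕ) (f : Cθ3) :
    facetForm i - C (j : ℂ) ∣ f ↔ aeval (facetParam j i) f = 0 := by
  refine dvd_iff_of_aeval_section _ (facetSection j i) ?_ (fun k ↦ ?_) f
  · fin_cases i <;> simp [facetForm, facetParam]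
  · fin_cases i <;> fin_cases k <;> simp [facetForm, facetParam, facetSection, sub_sub]
    all_goals exact ⟨0, by ring⟩

lemma eval_facetForm (i : Fin 4) (a : ℤ × ℤ × ℤ) :
    eval ![(a.1 : ℂ), (a.2.1 : ℂ), (a.2.2 : ℂ)] (facetForm i) = supportFn a i := by
  fin_cases i <;> simp [facetForm, supportFn]

lemma eval_aeval_facetParam (i : Fin 4) (j : ℕ) (n : Fin 3 → ℕ) (f : Cθ3) :
    eval (fun k ↦ (n k : ℂ)) (aeval (facetParam j i) f) =
      eval ![((facetPoint j n i).1 : ℂ), ((facetPoint j n i).2.1 : ℂ),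
        ((facetPoint j n i).2.2 : ℂ)] f := by
  have h : (aeval fun k ↦ (n k : ℂ)).comp (aeval (facetParam j i)) =
      (aeval ![((facetPoint j n i).1 : ℂ), ((facetPoint j n i).2.1 : ℂ),
        ((facetPoint j n i).2.2 : ℂ)] : Cθ3 →ₐ[ℂ] ℂ) := by
    ext k
    fin_cases i <;> fin_cases k <;> simp [facetParam, facetPoint]
  exact DFunLike.congr_fun h f

lemma supportFn_facetPoint (i : Fin 4) (j : ℕ) (n : Fin 3 → ℕ) :
    supportFn (facetPoint j n i) i = j := by
  fin_cases i <;> simp [supportFn, facetPoint]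

lemma facetPoint_mem (i : Fin 4) (j : ℕ) (n : Fin 3 → ℕ) : facetPoint j n i ∈ Sset3 := by
  fin_cases i <;> simp [facetPoint, Sset3] <;> omega

/-- The points of `S` on the plane `H_i = j` are Zariski dense in it. -/
lemma facetForm_sub_dvd_of_eval_eq_zero (i : Fin 4) (j : ℕ) (f : Cθ3)
    (h : ∀ a ∈ Sset3, supportFn a i = j →
      eval ![(a.1 : ℂ), (a.2.1 : ℂ), (a.2.2 : ℂ)] f = 0) :
    facetForm i - C (j : ℂ) ∣ f := by
  rw [facetForm_sub_dvd_iff]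
  refine funext_set (fun _ ↦ Set.range ((↑) : ℕ → ℂ))
    (fun _ ↦ Set.infinite_range_of_injective Nat.cast_injective) fun x hx ↦ ?_
  choose n hn using fun k ↦ hx k (Set.mem_univ k)
  obtain rfl : (fun k ↦ (n k : ℂ)) = x := funext hn
  rw [eval_aeval_facetParam, map_zero]
  exact h _ (facetPoint_mem i j n) (supportFn_facetPoint i j n)

lemma supportFn_eq_of_dvd {i k : Fin 4} {j l : ℕ}
    (h : facetForm i - C (j : ℂ) ∣ facetForm k - C (l : ℂ)) (n : Fin 3 → ℕ) :
    supportFn (facetPoint j n i) k = l := by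
  have := eval_aeval_facetParam i j n (facetForm k - C (l : ℂ))
  rw [(facetForm_sub_dvd_iff i j _).1 h, map_zero, map_sub, eval_facetForm, eval_C, eq_comm,
    sub_eq_zero] at this
  exact_mod_cast this

lemma eq_of_facetForm_sub_dvd {i k : Fin 4} {j l : ℕ}
    (h : facetForm i - C (j : ℂ) ∣ facetForm k - C (l : ℂ)) : i = k ∧ j = l := by
  have h0 := supportFn_eq_of_dvd h ![0, 0, 0]
  have h1 := supportFn_eq_of_dvd h ![1, 0, 0]
  have h2 := supportFn_eq_of_dvd h ![0, 1, 0]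
  have h3 := supportFn_eq_of_dvd h ![0, 0, 1]
  fin_cases i <;> fin_cases k <;> simp [supportFn, facetPoint] at h0 h1 h2 h3 ⊢ <;> omega

lemma prime_facetForm_sub (i : Fin 4) (j : ℕ) : Prime (facetForm i - C (j : ℂ)) := by
  refine ⟨fun h ↦ ?_, fun h ↦ ?_, fun a b hab ↦ ?_⟩
  · have := (eq_of_facetForm_sub_dvd (i := i) (j := j + 1) (h ▸ dvd_zero _)).2
    omega
  · have := (eq_of_facetForm_sub_dvd (k := i) (l := j + 1) h.dvd).2
    omega
  · simpa only [facetForm_sub_dvd_iff, map_mul, mul_eq_zero] using hab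

lemma mem_JMon3_iff (a : ℤ × ℤ × ℤ) : a ∈ JMon3 ↔ ∀ i, 0 < supportFn a i := by
  simp only [JMon3, Sset3, Set.mem_ofPred_eq, Fin.forall_fin_succ, supportFn]
  simp
  omega

lemma supportFn_add (a d : ℤ × ℤ × ℤ) (i : Fin 4) :
    supportFn (a + d) i = supportFn a i + supportFn d i := by
  fin_cases i <;> simp [supportFn] <;> ring

lemma supportFn_nonneg {a : ℤ × ℤ × ℤ} (ha : a ∈ Sset3) (i : Fin 4) : 0 ≤ supportFn a i := by
  obtain ⟨h1, h2, h3, h4⟩ := ha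
  fin_cases i <;> simp [supportFn] <;> omega

lemma ite_dfact (P : Cθ3) (m : ℤ) :
    (if m ≤ 0 then dfact P (-m) else 1) = dfact P (-m) := by
  split_ifs with h
  · rfl
  · rw [dfact, Int.toNat_of_nonpos (by omega), Finset.prod_range_zero]

lemma mem_vanishingIdeal_iff_dvd (d : ℤ × ℤ × ℤ) (f : Cθ3) :
    f ∈ vanishingIdeal {a | a ∈ Sset3 ∧ a + d ∉ JMon3} ↔
      ∏ i, dfact (facetForm i) (-supportFn d i) ∣ f := by
  constructor
  · intro hf
    simp only [dfact]
    rw [Finset.prod_sigma']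
    refine Finset.prod_dvd_of_isRelPrime ?_ ?_
    · rintro ⟨i, j⟩ - ⟨k, l⟩ - hne
      refine (prime_facetForm_sub i j).irreducible.isRelPrime_iff_not_dvd.2 fun h ↦ hne ?_
      obtain ⟨rfl, rfl⟩ := eq_of_facetForm_sub_dvd h
      rfl
    · rintro ⟨i, j⟩ hij
      simp only [Finset.mem_sigma, Finset.mem_univ, Finset.mem_range, true_and] at hij
      refine facetForm_sub_dvd_of_eval_eq_zero i j f fun a ha haj ↦ hf a ⟨ha, fun hJ ↦ ?_⟩
      have := (mem_JMon3_iff _).1 hJ i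
      rw [supportFn_add] at this
      omega
  · rintro ⟨c, rfl⟩ a ⟨ha, haJ⟩
    rw [mem_JMon3_iff] at haJ
    push Not at haJ
    obtain ⟨i, hi⟩ := haJ
    rw [supportFn_add] at hi
    have h0 := supportFn_nonneg ha i
    have hc : (((supportFn a i).toNat : ℕ) : ℂ) = supportFn a i := by
      exact_mod_cast congrArg (Int.cast : ℤ → ℂ) (Int.toNat_of_nonneg h0)
    rw [map_mul, map_prod, Finset.prod_eq_zero (Finset.mem_univ i), zero_mul]
    rw [dfact, map_prod]
    refine Finset.prod_eq_zero (i := (supportFn a i).toNat)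
      (Finset.mem_range.2 (by omega)) ?_
    rw [map_sub, eval_facetForm, eval_C, hc, sub_self]

/-- All graded pieces of `D(R_A, J)` for `J = ⟨t₁²t₂t₃⟩`: the vanishing ideal of
`{a ∈ S : a + d ∉ JMon}` is principal, generated by
`∏_{i : h_i(d) ≤ 0} (H_i, h_i(−d))!` where `H₁ = θ₃`, `H₂ = θ₂`, `H₃ = θ₁ − θ₃`,
`H₄ = θ₁ − θ₂` (empty product equal to `1`). -/
theorem statement14 (d : ℤ × ℤ × ℤ) :
    vanishingIdeal {a | a ∈ Sset3 ∧ a + d ∉ JMon3} =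
      Ideal.span
        {(if d.2.2 ≤ 0 then dfact (X 2) (-d.2.2) else 1) *
          (if d.2.1 ≤ 0 then dfact (X 1) (-d.2.1) else 1) *
          (if d.1 - d.2.2 ≤ 0 then dfact (X 0 - X 2) (-(d.1 - d.2.2)) else 1) *
          (if d.1 - d.2.1 ≤ 0 then dfact (X 0 - X 1) (-(d.1 - d.2.1)) else 1)} := by
  ext f
  rw [mem_vanishingIdeal_iff_dvd, Ideal.mem_span_singleton]
  simp only [ite_dfact, Fin.prod_univ_four]
  rfl

end
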